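/- Let θ be an irrational real number, let A be a unital C*-algebra, and let u, v be unitary elements of A satisfying the θ-commutation relation u·v = exp(2πiθ)·(v·u). Let p, q, r, s be integers with p·s − q·r = 1, and let 𝔄 denote the topological closure of the star-subalgebra of A generated by {u, v}. Then there exists a star-algebra automorphism φ of 𝔄 with φ(u) = u^p·v^q and φ(v) = u^r·v^s (integer powers taken in the unitary group). -/

import Mathlib

open scoped Real

/-- Membership of a generator in the C*-subalgebra (closure of the star-subalgebra) it
generates. -/
theorem mem_closure_adjoin_of_mem'' {A : Type*} [CStarAlgebra A] (s : Set A) {x : A}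
    (hx : x ∈ s) : x ∈ (StarAlgebra.adjoin ℂ s).topologicalClosure :=
  StarSubalgebra.le_topologicalClosure _ (StarAlgebra.subset_adjoin ℂ s hx)

open Filter Topology

section Monomial

variable {G : Type*} [Group G] {u v z : G}

theorem zpow_mul_zpow_of_central (hz : ∀ g, Commute z g) (h : u * v = z * (v * u)) (m n : ℤ) :
    u ^ m * v ^ n = z ^ (m * n) * (v ^ n * u ^ m) := by
  have h₁ : SemiconjBy u v (z * v) := by rw [SemiconjBy, h, mul_assoc]
  have h₂ : u * v ^ n = z ^ n * v ^ n * u := by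
    have := (h₁.zpow_right n).eq
    rwa [(hz v).mul_zpow] at this
  have h₃ : SemiconjBy (v ^ n) (z ^ n * u) u := by
    rw [SemiconjBy, h₂, ← mul_assoc, ((hz (v ^ n)).zpow_left n).eq]
  have h₄ := (h₃.zpow_right m).eq
  rw [((hz u).zpow_left n).mul_zpow, ← zpow_mul] at h₄
  rw [← h₄, ← mul_assoc, ← mul_assoc, ((hz (v ^ n)).zpow_left (m * n)).eq, mul_comm n m]

/-- `g` is the monomial `u ^ m * v ^ n` up to a power of `z`. -/
def IsMonomial (z u v : G) (m n : ℤ) (g : G) : Prop :=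
  ∃ k : ℤ, g = z ^ k * (u ^ m * v ^ n)

theorem monomial_mul_monomial (hz : ∀ g, Commute z g) (h : u * v = z * (v * u))
    (k m n k' m' n' : ℤ) :
    z ^ k * (u ^ m * v ^ n) * (z ^ k' * (u ^ m' * v ^ n')) =
      z ^ (k + k' - m' * n) * (u ^ (m + m') * v ^ (n + n')) := by
  have hc : ∀ (j : ℤ) (g : G), g * z ^ j = z ^ j * g := fun j g => ((hz g).zpow_left j).eq.symm
  have h₁ : v ^ n * u ^ m' = z ^ (-(m' * n)) * (u ^ m' * v ^ n) := by
    rw [zpow_mul_zpow_of_central hz h m' n, ← mul_assoc, ← zpow_add]; simp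
  calc z ^ k * (u ^ m * v ^ n) * (z ^ k' * (u ^ m' * v ^ n'))
      = z ^ k * (u ^ m * v ^ n * z ^ k') * (u ^ m' * v ^ n') := by group
    _ = z ^ k * z ^ k' * u ^ m * (v ^ n * u ^ m') * v ^ n' := by rw [hc]; group
    _ = z ^ k * z ^ k' * (u ^ m * z ^ (-(m' * n))) * u ^ m' * v ^ n * v ^ n' := by
        rw [h₁]; simp only [mul_assoc]
    _ = z ^ k * z ^ k' * z ^ (-(m' * n)) * u ^ m * u ^ m' * v ^ n * v ^ n' := by
        rw [hc _ (u ^ m)]; simp only [mul_assoc]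
    _ = _ := by simp only [sub_eq_add_neg, zpow_add, mul_assoc]

theorem IsMonomial.mul (hz : ∀ g, Commute z g) (h : u * v = z * (v * u)) {m n m' n' : ℤ}
    {g g' : G} (hg : IsMonomial z u v m n g) (hg' : IsMonomial z u v m' n' g') :
    IsMonomial z u v (m + m') (n + n') (g * g') := by
  obtain ⟨k, rfl⟩ := hg
  obtain ⟨k', rfl⟩ := hg'
  exact ⟨_, monomial_mul_monomial hz h ..⟩

theorem IsMonomial.inv (hz : ∀ g, Commute z g) (h : u * v = z * (v * u)) {m n : ℤ}
    {g : G} (hg : IsMonomial z u v m n g) : IsMonomial z u v (-m) (-n) g⁻¹ := by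
  obtain ⟨k, rfl⟩ := hg
  refine ⟨-k - m * n, ?_⟩
  rw [inv_eq_iff_mul_eq_one, monomial_mul_monomial hz h]
  rw [show k + (-k - m * n) - -m * n = 0 by ring]
  simp

theorem IsMonomial.zpow (hz : ∀ g, Commute z g) (h : u * v = z * (v * u)) {m n : ℤ}
    {g : G} (hg : IsMonomial z u v m n g) (l : ℤ) :
    IsMonomial z u v (l * m) (l * n) (g ^ l) := by
  induction l with
  | zero => exact ⟨0, by simp⟩
  | succ i ih =>
    rw [zpow_add_one, add_mul, add_mul, one_mul, one_mul]
    exact ih.mul hz h hg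
  | pred i ih =>
    rw [zpow_sub_one, sub_mul, sub_mul, one_mul, one_mul]
    exact ih.mul hz h (hg.inv hz h)

theorem IsMonomial.mul_comm (hz : ∀ g, Commute z g) (h : u * v = z * (v * u)) {m n m' n' : ℤ}
    {g g' : G} (hg : IsMonomial z u v m n g) (hg' : IsMonomial z u v m' n' g') :
    g * g' = z ^ (m * n' - n * m') * (g' * g) := by
  obtain ⟨k, rfl⟩ := hg
  obtain ⟨k', rfl⟩ := hg'
  rw [monomial_mul_monomial hz h, monomial_mul_monomial hz h, ← mul_assoc (z ^ _) (z ^ _),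
    ← zpow_add, add_comm m', add_comm n']
  congr 2
  ring

theorem isMonomial_left : IsMonomial z u v 1 0 u := ⟨0, by simp⟩

theorem isMonomial_right : IsMonomial z u v 0 1 v := ⟨0, by simp⟩

theorem isMonomial_one : IsMonomial z u v 0 0 1 := ⟨0, by simp⟩

theorem isMonomial_zpow_mul_zpow (m n : ℤ) : IsMonomial z u v m n (u ^ m * v ^ n) := ⟨0, by simp⟩

end Monomial

section Scalar

variable {C : Type*} [CStarAlgebra C]

variable (C) in
/-- Scalars of modulus one, as unitaries of a C⋆-algebra. -/
noncomputable def scalarUnitary : unitary ℂ →* unitary C where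
  toFun ζ := ⟨algebraMap ℂ C ζ, Unitary.map_mem (StarAlgHom.ofId ℂ C) ζ.2⟩
  map_one' := Subtype.ext (map_one (algebraMap ℂ C))
  map_mul' _ _ := Subtype.ext (map_mul (algebraMap ℂ C) _ _)

theorem coe_scalarUnitary (ζ : unitary ℂ) :
    (scalarUnitary C ζ : C) = algebraMap ℂ C (ζ : ℂ) := rfl

theorem scalarUnitary_commute (ζ : unitary ℂ) (g : unitary C) :
    Commute (scalarUnitary C ζ) g :=
  Subtype.ext (by simpa [coe_scalarUnitary] using Algebra.commutes (ζ : ℂ) (g : C))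

theorem coe_scalarUnitary_zpow_mul (ζ : unitary ℂ) (k : ℤ) (g : unitary C) :
    ((scalarUnitary C ζ ^ k * g : unitary C) : C) = ((ζ : ℂ) ^ k) • (g : C) := by
  rw [← map_zpow, Submonoid.coe_mul, coe_scalarUnitary, Unitary.coe_zpow, ← Algebra.smul_def]

end Scalar

section Span

variable {C : Type*} [CStarAlgebra C] {ζ : unitary ℂ} {u v : unitary C}

theorem IsMonomial.mem_adjoin {m n : ℤ} {g : unitary C}
    (hg : IsMonomial (scalarUnitary C ζ) u v m n g) :
    (g : C) ∈ StarAlgebra.adjoin ℂ ({↑u, ↑v} : Set C) := by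
  have aux : ∀ w : unitary C, (w : C) ∈ StarAlgebra.adjoin ℂ ({↑u, ↑v} : Set C) → ∀ l : ℤ,
      ((w ^ l : unitary C) : C) ∈ StarAlgebra.adjoin ℂ ({↑u, ↑v} : Set C) := by
    intro w hw l
    cases l with
    | ofNat l => simpa using pow_mem hw l
    | negSucc l =>
      rw [zpow_negSucc, ← Unitary.star_eq_inv, Unitary.coe_star]
      exact star_mem (by simpa using pow_mem hw (l + 1))
  obtain ⟨k, rfl⟩ := hg
  rw [coe_scalarUnitary_zpow_mul]
  exact SMulMemClass.smul_mem _ (mul_mem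
    (aux u (StarAlgebra.subset_adjoin ℂ _ (by simp)) m)
    (aux v (StarAlgebra.subset_adjoin ℂ _ (by simp)) n))

/-- The star-subalgebra generated by two unitaries commuting up to a scalar is spanned by
monomials. -/
theorem adjoin_monomial_induction (h : u * v = scalarUnitary C ζ * (v * u)) {p : C → Prop}
    (monomial : ∀ (m n : ℤ) (g : unitary C), IsMonomial (scalarUnitary C ζ) u v m n g → p g)
    (add : ∀ x y, p x → p y → p (x + y)) (smul : ∀ (c : ℂ) x, p x → p (c • x))
    {x : C} (hx : x ∈ StarAlgebra.adjoin ℂ ({↑u, ↑v} : Set C)) : p x := by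
  have hz := scalarUnitary_commute (C := C) ζ
  have hmon : ∀ w ∈ Submonoid.closure (({↑u, ↑v} : Set C) ∪ star {↑u, ↑v}),
      ∃ (m n : ℤ) (g : unitary C), IsMonomial (scalarUnitary C ζ) u v m n g ∧ (g : C) = w := by
    intro w hw
    induction hw using Submonoid.closure_induction with
    | mem w hw =>
      rcases hw with (rfl | rfl) | hw
      · exact ⟨_, _, _, isMonomial_left, rfl⟩
      · exact ⟨_, _, _, isMonomial_right, rfl⟩
      · rcases Set.mem_star.1 hw with hw | hw
        · refine ⟨_, _, _, isMonomial_left.inv hz h, ?_⟩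
          rw [← star_star w, hw]; rfl
        · refine ⟨_, _, _, isMonomial_right.inv hz h, ?_⟩
          rw [← star_star w, hw]; rfl
    | one => exact ⟨_, _, _, isMonomial_one, rfl⟩
    | mul w w' _ _ ih ih' =>
      obtain ⟨m, n, g, hg, rfl⟩ := ih
      obtain ⟨m', n', g', hg', rfl⟩ := ih'
      exact ⟨_, _, _, hg.mul hz h hg', rfl⟩
  replace hx : x ∈ Submodule.span ℂ
      (Submonoid.closure (({↑u, ↑v} : Set C) ∪ star {↑u, ↑v}) : Set C) := by
    rw [← StarAlgebra.adjoin_eq_span]; exact hx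
  induction hx using Submodule.span_induction with
  | mem w hw =>
    obtain ⟨m, n, g, hg, rfl⟩ := hmon w hw
    exact monomial m n g hg
  | zero => simpa using smul 0 _ (monomial _ _ _ isMonomial_one)
  | add x y _ _ ihx ihy => exact add x y ihx ihy
  | smul c x _ ih => exact smul c x ih

theorem IsMonomial.conj (h : u * v = scalarUnitary C ζ * (v * u)) {m n m' n' : ℤ}
    {g w : unitary C} (hg : IsMonomial (scalarUnitary C ζ) u v m n g)
    (hw : IsMonomial (scalarUnitary C ζ) u v m' n' w) :
    Unitary.conjStarAlgAut ℂ C g w = ((ζ : ℂ) ^ (m * n' - n * m')) • (w : C) := by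
  rw [← coe_scalarUnitary_zpow_mul]
  have := hg.mul_comm (scalarUnitary_commute ζ) h hw
  rw [← mul_assoc, ← mul_inv_eq_iff_eq_mul] at this
  rw [← this]
  rfl

end Span

section Average

variable {C : Type*} [CStarAlgebra C]

theorem norm_conjStarAlgAut (g : unitary C) (x : C) :
    ‖Unitary.conjStarAlgAut ℂ C g x‖ = ‖x‖ := by
  simp [CStarRing.norm_coe_unitary_mul, ← Unitary.coe_star, CStarRing.norm_mul_coe_unitary]

/-- The average of `x` over the conjugations by `u ^ i * v ^ j` for `i, j < N`. -/
noncomputable def conjAverage (u v : unitary C) (N : ℕ) (x : C) : C :=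
  ((N : ℂ)⁻¹ * (N : ℂ)⁻¹) • ∑ i ∈ Finset.range N, ∑ j ∈ Finset.range N,
    Unitary.conjStarAlgAut ℂ C (u ^ i * v ^ j) x

variable (u v : unitary C)

theorem conjAverage_add (N : ℕ) (x y : C) :
    conjAverage u v N (x + y) = conjAverage u v N x + conjAverage u v N y := by
  simp only [conjAverage, map_add, Finset.sum_add_distrib, smul_add]

theorem conjAverage_smul (N : ℕ) (c : ℂ) (x : C) :
    conjAverage u v N (c • x) = c • conjAverage u v N x := by
  simp only [conjAverage, map_smul, ← Finset.smul_sum, smul_comm c]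

theorem norm_conjAverage_le (N : ℕ) (x : C) : ‖conjAverage u v N x‖ ≤ ‖x‖ := by
  have h : ‖∑ i ∈ Finset.range N, ∑ j ∈ Finset.range N,
      Unitary.conjStarAlgAut ℂ C (u ^ i * v ^ j) x‖ ≤ N * (N * ‖x‖) := by
    refine (norm_sum_le_of_le _ fun i _ => norm_sum_le_of_le _ fun j _ =>
      (norm_conjStarAlgAut _ x).le).trans_eq ?_
    simp
  rw [conjAverage, norm_smul, norm_mul, norm_inv, Complex.norm_natCast]
  rcases N.eq_zero_or_pos with rfl | hN
  · simp
  · have hN' : (0 : ℝ) < N := by exact_mod_cast hN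
    calc _ ≤ (N : ℝ)⁻¹ * (N : ℝ)⁻¹ * (N * (N * ‖x‖)) := by gcongr
      _ = ‖x‖ := by field_simp

theorem tendsto_inv_mul_geom_sum {lam : ℂ} (h : ‖lam‖ = 1) (h1 : lam ≠ 1) :
    Tendsto (fun N : ℕ => (N : ℂ)⁻¹ * ∑ i ∈ Finset.range N, lam ^ i) atTop (𝓝 0) := by
  have hb : ∀ N : ℕ, ‖(N : ℂ)⁻¹ * ∑ i ∈ Finset.range N, lam ^ i‖ ≤
      (N : ℝ)⁻¹ * (2 / ‖lam - 1‖) := by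
    intro N
    rw [norm_mul, norm_inv, Complex.norm_natCast, geom_sum_eq h1, norm_div]
    gcongr
    calc ‖lam ^ N - 1‖ ≤ ‖lam ^ N‖ + ‖(1 : ℂ)‖ := norm_sub_le _ _
      _ = 2 := by rw [norm_pow, h]; norm_num
  refine squeeze_zero_norm hb ?_
  simpa using (tendsto_inv_atTop_nhds_zero_nat (𝕜 := ℝ)).mul_const (2 / ‖lam - 1‖)

theorem norm_inv_mul_geom_sum_le {lam : ℂ} (h : ‖lam‖ = 1) (N : ℕ) :
    ‖(N : ℂ)⁻¹ * ∑ i ∈ Finset.range N, lam ^ i‖ ≤ 1 := by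
  have : ‖∑ i ∈ Finset.range N, lam ^ i‖ ≤ N :=
    (norm_sum_le_of_le _ fun i _ => (by rw [norm_pow, h, one_pow] : ‖lam ^ i‖ ≤ 1)).trans_eq
      (by simp)
  rw [norm_mul, norm_inv, Complex.norm_natCast]
  exact (mul_le_mul_of_nonneg_left this (by positivity)).trans
    (inv_mul_le_one_of_le₀ le_rfl (by positivity))

theorem tendsto_geom_sum_mul_geom_sum {lam mu : ℂ} (hl : ‖lam‖ = 1) (hm : ‖mu‖ = 1)
    (h1 : lam ≠ 1 ∨ mu ≠ 1) :
    Tendsto (fun N : ℕ => ((N : ℂ)⁻¹ * ∑ i ∈ Finset.range N, lam ^ i) *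
      ((N : ℂ)⁻¹ * ∑ i ∈ Finset.range N, mu ^ i)) atTop (𝓝 0) := by
  rcases h1 with h1 | h1
  · refine squeeze_zero_norm (fun N => ?_)
      (tendsto_zero_iff_norm_tendsto_zero.1 (tendsto_inv_mul_geom_sum hl h1))
    rw [norm_mul]
    exact mul_le_of_le_one_right (norm_nonneg _) (norm_inv_mul_geom_sum_le hm N)
  · refine squeeze_zero_norm (fun N => ?_)
      (tendsto_zero_iff_norm_tendsto_zero.1 (tendsto_inv_mul_geom_sum hm h1))
    rw [norm_mul]
    exact mul_le_of_le_one_left (norm_nonneg _) (norm_inv_mul_geom_sum_le hl N)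

variable {u v}

theorem le_conjAverage [PartialOrder C] [StarOrderedRing C] {N : ℕ} (hN : 0 < N) {b x : C}
    (hb : ∀ i j : ℕ, b ≤ Unitary.conjStarAlgAut ℂ C (u ^ i * v ^ j) x) :
    b ≤ conjAverage u v N x := by
  have hN' : (N : ℝ) ≠ 0 := by exact_mod_cast hN.ne'
  have hsum : (N : ℝ) • ((N : ℝ) • b) ≤ ∑ i ∈ Finset.range N, ∑ j ∈ Finset.range N,
      Unitary.conjStarAlgAut ℂ C (u ^ i * v ^ j) x := by
    have := Finset.sum_le_sum fun i (_ : i ∈ Finset.range N) =>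
      Finset.sum_le_sum fun j (_ : j ∈ Finset.range N) => hb i j
    simpa only [Finset.sum_const, Finset.card_range, ← Nat.cast_smul_eq_nsmul ℝ] using this
  have hav : conjAverage u v N x = ((N : ℝ)⁻¹ * (N : ℝ)⁻¹) • ∑ i ∈ Finset.range N,
      ∑ j ∈ Finset.range N, Unitary.conjStarAlgAut ℂ C (u ^ i * v ^ j) x := by
    rw [conjAverage, ← Complex.coe_smul]
    push_cast
    rfl
  calc b = ((N : ℝ)⁻¹ * (N : ℝ)⁻¹) • ((N : ℝ) • ((N : ℝ) • b)) := by
        rw [smul_smul, smul_smul]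
        field_simp
        simp
    _ ≤ conjAverage u v N x := by
        rw [hav]
        exact smul_le_smul_of_nonneg_left hsum (by positivity)

theorem conjAverage_eigenvector {w : C} {lam mu : ℂ}
    (hw : ∀ i j : ℕ, Unitary.conjStarAlgAut ℂ C (u ^ i * v ^ j) w = (lam ^ i * mu ^ j) • w)
    (N : ℕ) : conjAverage u v N w = (((N : ℂ)⁻¹ * ∑ i ∈ Finset.range N, lam ^ i) *
      ((N : ℂ)⁻¹ * ∑ i ∈ Finset.range N, mu ^ i)) • w := by
  simp only [conjAverage, hw, ← Finset.sum_smul, smul_smul, ← Finset.mul_sum, ← Finset.sum_mul]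
  congr 1
  ring

end Average

section Faithful

variable {C : Type*} [CStarAlgebra C] {ζ : unitary ℂ} {u v : unitary C}

theorem isMonomial_pow_mul_pow (z : unitary C) (i j : ℕ) :
    IsMonomial z u v i j (u ^ i * v ^ j) := by
  simpa using isMonomial_zpow_mul_zpow (z := z) (u := u) (v := v) i j

theorem IsMonomial.conj_pow_mul_pow (h : u * v = scalarUnitary C ζ * (v * u)) {m n : ℤ}
    {w : unitary C} (hw : IsMonomial (scalarUnitary C ζ) u v m n w) (i j : ℕ) :
    Unitary.conjStarAlgAut ℂ C (u ^ i * v ^ j) w =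
      (((ζ : ℂ) ^ n) ^ i * ((ζ : ℂ) ^ (-m)) ^ j) • (w : C) := by
  have h0 : (ζ : ℂ) ≠ 0 := norm_ne_zero_iff.1 (by simp)
  rw [(isMonomial_pow_mul_pow _ i j).conj h hw, ← zpow_natCast, ← zpow_natCast, ← zpow_mul,
    ← zpow_mul, ← zpow_add₀ h0]
  congr 2
  ring

/-- If `ζ` is not a root of unity, averages converge to scalars on the star-subalgebra generated
by `u` and `v`. -/
theorem exists_tendsto_conjAverage (hζ : ∀ n : ℤ, (ζ : ℂ) ^ n = 1 → n = 0)
    (h : u * v = scalarUnitary C ζ * (v * u)) {x : C}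
    (hx : x ∈ StarAlgebra.adjoin ℂ ({↑u, ↑v} : Set C)) :
    ∃ c : ℂ, Tendsto (fun N => conjAverage u v N x) atTop (𝓝 (algebraMap ℂ C c)) := by
  refine adjoin_monomial_induction (p := fun x => ∃ c : ℂ,
    Tendsto (fun N => conjAverage u v N x) atTop (𝓝 (algebraMap ℂ C c))) h ?_ ?_ ?_ hx
  · intro m n w hw
    have hav := conjAverage_eigenvector (hw.conj_pow_mul_pow h)
    by_cases hmn : m = 0 ∧ n = 0
    · obtain ⟨rfl, rfl⟩ := hmn
      obtain ⟨k, rfl⟩ := hw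
      refine ⟨(ζ : ℂ) ^ k, tendsto_const_nhds.congr' ?_⟩
      filter_upwards [eventually_ne_atTop 0] with N hN
      have hN' : (N : ℂ) ≠ 0 := by exact_mod_cast hN
      rw [hav, coe_scalarUnitary_zpow_mul]
      simp [hN', Algebra.algebraMap_eq_smul_one]
    · refine ⟨0, ?_⟩
      simp only [hav]
      have h1 : (ζ : ℂ) ^ n ≠ 1 ∨ (ζ : ℂ) ^ (-m) ≠ 1 := by
        by_contra! hcon
        exact hmn ⟨neg_eq_zero.1 (hζ _ hcon.2), hζ _ hcon.1⟩
      simpa using (tendsto_geom_sum_mul_geom_sum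
        (by simp) (by simp) h1).smul_const
          (w : C)
  · rintro x y ⟨c, hc⟩ ⟨d, hd⟩
    exact ⟨c + d, by simpa only [conjAverage_add, map_add] using hc.add hd⟩
  · rintro a x ⟨c, hc⟩
    refine ⟨a * c, ?_⟩
    simpa only [conjAverage_smul, map_mul, ← Algebra.smul_def] using hc.const_smul a

theorem exists_norm_conjAverage_sub_lt (hζ : ∀ n : ℤ, (ζ : ℂ) ^ n = 1 → n = 0)
    (h : u * v = scalarUnitary C ζ * (v * u)) {x : C}
    (hx : x ∈ (StarAlgebra.adjoin ℂ ({↑u, ↑v} : Set C)).topologicalClosure) {ε : ℝ} (hε : 0 < ε) :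
    ∃ N : ℕ, 0 < N ∧ ∃ c : ℂ, ‖conjAverage u v N x - algebraMap ℂ C c‖ < ε := by
  obtain ⟨y, hy, hxy⟩ := Metric.mem_closure_iff.1 hx (ε / 2) (half_pos hε)
  obtain ⟨c, hc⟩ := exists_tendsto_conjAverage hζ h hy
  obtain ⟨N, hN, hN0⟩ := (((Metric.tendsto_nhds.1 hc) (ε / 2) (half_pos hε)).and
    (eventually_gt_atTop 0)).exists
  refine ⟨N, hN0, c, ?_⟩
  have hsplit : conjAverage u v N x - algebraMap ℂ C c =
      conjAverage u v N (x - y) + (conjAverage u v N y - algebraMap ℂ C c) := by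
    rw [← add_sub_assoc, ← conjAverage_add, sub_add_cancel]
  rw [hsplit]
  rw [dist_eq_norm] at hN hxy
  linarith [norm_add_le (conjAverage u v N (x - y)) (conjAverage u v N y - algebraMap ℂ C c),
    norm_conjAverage_le u v N (x - y)]

open scoped Pointwise in
/-- Orbits under conjugation by the unitaries `star (u ^ i * v ^ j)` are relatively compact. -/
theorem totallyBounded_range_conj (h : u * v = scalarUnitary C ζ * (v * u)) {x : C}
    (hx : x ∈ (StarAlgebra.adjoin ℂ ({↑u, ↑v} : Set C)).topologicalClosure) :
    TotallyBounded (Set.range fun ij : ℕ × ℕ =>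
      Unitary.conjStarAlgAut ℂ C (u ^ ij.1 * v ^ ij.2)⁻¹ x) := by
  have hz := scalarUnitary_commute (C := C) ζ
  have key : ∀ y ∈ StarAlgebra.adjoin ℂ ({↑u, ↑v} : Set C), ∃ K : Set C, IsCompact K ∧
      ∀ i j : ℕ, Unitary.conjStarAlgAut ℂ C (u ^ i * v ^ j)⁻¹ y ∈ K := by
    intro y hy
    refine adjoin_monomial_induction (p := fun y => ∃ K : Set C, IsCompact K ∧
      ∀ i j : ℕ, Unitary.conjStarAlgAut ℂ C (u ^ i * v ^ j)⁻¹ y ∈ K) h ?_ ?_ ?_ hy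
    · intro m n w hw
      refine ⟨(fun c : ℂ => c • (w : C)) '' Metric.sphere 0 1,
        (isCompact_sphere _ _).image (by fun_prop), fun i j => ?_⟩
      rw [((isMonomial_pow_mul_pow _ i j).inv hz h).conj h hw]
      exact ⟨_, by simp, rfl⟩
    · rintro x y ⟨K, hK, hxK⟩ ⟨L, hL, hyL⟩
      exact ⟨K + L, hK.add hL, fun i j => by
        rw [map_add]; exact Set.add_mem_add (hxK i j) (hyL i j)⟩
    · rintro a x ⟨K, hK, hxK⟩
      exact ⟨(a • ·) '' K, hK.image (by fun_prop), fun i j => by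
        rw [map_smul]; exact ⟨_, hxK i j, rfl⟩⟩
  rw [Metric.totallyBounded_iff]
  intro ε hε
  obtain ⟨y, hy, hxy⟩ := Metric.mem_closure_iff.1 hx (ε / 2) (half_pos hε)
  obtain ⟨K, hK, hyK⟩ := key y hy
  obtain ⟨t, ht, hKt⟩ := Metric.totallyBounded_iff.1 hK.totallyBounded (ε / 2) (half_pos hε)
  refine ⟨t, ht, ?_⟩
  rintro _ ⟨⟨i, j⟩, rfl⟩
  obtain ⟨a, ha, hya⟩ := Set.mem_iUnion₂.1 (hKt (hyK i j))
  refine Set.mem_iUnion₂.2 ⟨a, ha, ?_⟩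
  rw [Metric.mem_ball] at hya ⊢
  have h1 : dist (Unitary.conjStarAlgAut ℂ C (u ^ i * v ^ j)⁻¹ x)
      (Unitary.conjStarAlgAut ℂ C (u ^ i * v ^ j)⁻¹ y) = dist x y := by
    rw [dist_eq_norm, ← map_sub, norm_conjStarAlgAut, dist_eq_norm]
  linarith [dist_triangle (Unitary.conjStarAlgAut ℂ C (u ^ i * v ^ j)⁻¹ x)
    (Unitary.conjStarAlgAut ℂ C (u ^ i * v ^ j)⁻¹ y) a]

theorem conjStarAlgAut_mem (g : unitary C) {S : StarSubalgebra ℂ C} (hg : (g : C) ∈ S) {x : C}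
    (hx : x ∈ S) : Unitary.conjStarAlgAut ℂ C g x ∈ S := by
  rw [Unitary.conjStarAlgAut_apply]
  exact mul_mem (mul_mem hg hx) (star_mem hg)

/-- A ⋆-homomorphism to a nonzero C⋆-algebra is injective on the C⋆-algebra generated by two
unitaries which commute up to a scalar that is not a root of unity. -/
theorem eq_zero_of_map_eq_zero {D : Type*} [CStarAlgebra D] [Nontrivial D]
    (hζ : ∀ n : ℤ, (ζ : ℂ) ^ n = 1 → n = 0) (h : u * v = scalarUnitary C ζ * (v * u))
    (Φ : C →⋆ₐ[ℂ] D) {x : C}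
    (hx : x ∈ (StarAlgebra.adjoin ℂ ({↑u, ↑v} : Set C)).topologicalClosure)
    (hΦ : Φ x = 0) : x = 0 := by
  let _ := CStarAlgebra.spectralOrder C
  have := CStarAlgebra.spectralOrderedRing C
  have hz := scalarUnitary_commute (C := C) ζ
  set B := (StarAlgebra.adjoin ℂ ({↑u, ↑v} : Set C)).topologicalClosure with hB
  have hgB : ∀ i j : ℕ, (((u ^ i * v ^ j)⁻¹ : unitary C) : C) ∈ B := fun i j =>
    StarSubalgebra.le_topologicalClosure _ ((isMonomial_pow_mul_pow _ i j).inv hz h).mem_adjoin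
  have hΦconj : ∀ (g : unitary C) (a : C), Φ a = 0 → Φ (Unitary.conjStarAlgAut ℂ C g a) = 0 := by
    intro g a ha
    simp [ha]
  set y := star x * x with hy
  have hy0 : 0 ≤ y := star_mul_self_nonneg x
  have hyB : y ∈ B := mul_mem (star_mem hx) hx
  have hΦy : Φ y = 0 := by simp [hy, hΦ]
  suffices ∀ ε > 0, ‖y‖ ≤ 3 * ε by
    have hny : ‖y‖ ≤ 0 := by
      refine le_of_forall_pos_le_add fun ε hε => ?_
      linarith [this (ε / 3) (by positivity)]
    exact CStarRing.star_mul_self_eq_zero_iff x |>.1 (norm_le_zero_iff.1 hny)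
  intro ε hε
  obtain ⟨t, hts, htf, hcov⟩ :=
    Metric.finite_approx_of_totallyBounded (totallyBounded_range_conj h hyB) ε hε
  have ht : ∀ a ∈ t, 0 ≤ a ∧ a ∈ B ∧ Φ a = 0 := by
    intro a ha
    obtain ⟨⟨i, j⟩, rfl⟩ := hts ha
    exact ⟨star_right_conjugate_nonneg hy0 _, conjStarAlgAut_mem _ (hgB i j) hyB,
      hΦconj _ _ hΦy⟩
  set S : C := ∑ a ∈ htf.toFinset, a with hS
  have hSB : S ∈ B := sum_mem fun a ha => (ht a (htf.mem_toFinset.1 ha)).2.1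
  have hΦS : Φ S = 0 := by
    rw [hS, map_sum]
    exact Finset.sum_eq_zero fun a ha => (ht a (htf.mem_toFinset.1 ha)).2.2
  have hlower : ∀ i j : ℕ, y - algebraMap ℝ C ε ≤
      Unitary.conjStarAlgAut ℂ C (u ^ i * v ^ j) S := by
    intro i j
    set g := u ^ i * v ^ j
    obtain ⟨a, ha, hya⟩ := Set.mem_iUnion₂.1 (hcov ⟨(i, j), rfl⟩)
    have haS : a ≤ S := Finset.single_le_sum
      (fun b hb => (ht b (htf.mem_toFinset.1 hb)).1) (htf.mem_toFinset.2 ha)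
    have hgaS : Unitary.conjStarAlgAut ℂ C g a ≤ Unitary.conjStarAlgAut ℂ C g S :=
      star_right_conjugate_le_conjugate haS _
    have hga0 : 0 ≤ Unitary.conjStarAlgAut ℂ C g a :=
      star_right_conjugate_nonneg (ht a ha).1 _
    have hgy : Unitary.conjStarAlgAut ℂ C g (Unitary.conjStarAlgAut ℂ C g⁻¹ y) = y := by
      rw [← Unitary.conjStarAlgAut_mul_apply, mul_inv_cancel]
      simp
    have hnorm : ‖y - Unitary.conjStarAlgAut ℂ C g a‖ ≤ ε := by
      rw [Metric.mem_ball, dist_eq_norm] at hya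
      calc _ = ‖Unitary.conjStarAlgAut ℂ C g (Unitary.conjStarAlgAut ℂ C g⁻¹ y - a)‖ := by
            rw [map_sub, hgy]
        _ ≤ ε := by rw [norm_conjStarAlgAut]; exact hya.le
    have hle : y - Unitary.conjStarAlgAut ℂ C g a ≤ algebraMap ℝ C ε :=
      (IsSelfAdjoint.le_algebraMap_norm_self
        ((IsSelfAdjoint.of_nonneg hy0).sub (IsSelfAdjoint.of_nonneg hga0))).trans
        (algebraMap_mono C hnorm)
    exact (sub_le_comm.1 hle).trans hgaS
  obtain ⟨N, hN, c, hNc⟩ := exists_norm_conjAverage_sub_lt hζ h hSB hε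
  have hc : ‖c‖ < ε := by
    have hΦav : Φ (conjAverage u v N S) = 0 := by
      rw [conjAverage, map_smul, map_sum]
      simp only [map_sum, hΦconj _ _ hΦS, Finset.sum_const_zero, smul_zero]
    have hle := (NonUnitalStarAlgHom.norm_apply_le Φ
      (conjAverage u v N S - algebraMap ℂ C c)).trans_lt hNc
    rwa [map_sub, hΦav, AlgHomClass.commutes, zero_sub, norm_neg, norm_algebraMap'] at hle
  have hnt : Nontrivial C := (Φ : C →+* D).domain_nontrivial
  have hav : ‖conjAverage u v N S‖ ≤ 2 * ε := by
    have := norm_le_norm_sub_add (conjAverage u v N S) (algebraMap ℂ C c)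
    rw [norm_algebraMap'] at this
    linarith
  have hyle : y ≤ conjAverage u v N S + algebraMap ℝ C ε :=
    sub_le_iff_le_add.1 (le_conjAverage hN hlower)
  calc ‖y‖ ≤ ‖conjAverage u v N S + algebraMap ℝ C ε‖ :=
        CStarAlgebra.norm_le_norm_of_nonneg_of_le hy0 hyle
    _ ≤ ‖conjAverage u v N S‖ + ‖algebraMap ℝ C ε‖ := norm_add_le _ _
    _ ≤ 3 * ε := by
        rw [norm_algebraMap', Real.norm_of_nonneg hε.le]
        linarith

end Faithful

section Torus

variable {A : Type*} [CStarAlgebra A] {ζ : unitary ℂ} {u v u' v' : unitary A}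

/-- A ⋆-homomorphism which is injective on the C⋆-algebra generated by `s` maps it isomorphically
onto the C⋆-algebra generated by the image of `s`. -/
theorem exists_starAlgEquiv_of_injOn {C D : Type*} [CStarAlgebra C] [CStarAlgebra D]
    (Φ : C →⋆ₐ[ℂ] D) (s : Set C)
    (hΦ : Set.InjOn Φ (StarAlgebra.adjoin ℂ s).topologicalClosure) {t : Set D}
    (ht : Φ '' s = t) :
    ∃ φ : (StarAlgebra.adjoin ℂ s).topologicalClosure ≃⋆ₐ[ℂ]
      (StarAlgebra.adjoin ℂ t).topologicalClosure, ∀ x, (φ x : D) = Φ x := by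
  subst ht
  set B := (StarAlgebra.adjoin ℂ s).topologicalClosure
  have hBc : IsClosed (B : Set C) := StarSubalgebra.isClosed_topologicalClosure _
  have : CompleteSpace B := hBc.completeSpace_coe
  let _ : CStarAlgebra B := { }
  let ρ : B →⋆ₐ[ℂ] D := Φ.comp B.subtype
  have hρ : Function.Injective ρ := fun x y hxy => Subtype.ext (hΦ x.2 y.2 hxy)
  have hcl : IsClosed (ρ.range : Set D) := by
    have := (NonUnitalStarAlgHom.isometry ρ hρ).isClosedEmbedding.isClosed_range
    exact this
  have hcont : Continuous Φ := AddMonoidHomClass.continuous_of_bound Φ 1 fun x => by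
    rw [one_mul]; exact NonUnitalStarAlgHom.norm_apply_le Φ x
  have hrange : ρ.range = (StarAlgebra.adjoin ℂ (Φ '' s)).topologicalClosure := by
    apply le_antisymm
    · rintro _ ⟨x, rfl⟩
      rw [← StarAlgHom.map_adjoin]
      exact StarSubalgebra.map_topologicalClosure_le _ Φ hcont ⟨x, x.2, rfl⟩
    · refine StarSubalgebra.topologicalClosure_minimal (StarAlgebra.adjoin_le ?_) hcl
      rintro _ ⟨x, hx, rfl⟩
      exact ⟨⟨x, mem_closure_adjoin_of_mem'' s hx⟩, rfl⟩
  let ψ := ρ.codRestrict (StarAlgebra.adjoin ℂ (Φ '' s)).topologicalClosure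
    fun x => hrange ▸ ⟨x, rfl⟩
  refine ⟨StarAlgEquiv.ofBijective ψ ⟨fun x y hxy => hρ (congrArg Subtype.val hxy), ?_⟩,
    fun x => rfl⟩
  rintro ⟨y, hy⟩
  obtain ⟨x, rfl⟩ : y ∈ ρ.range := hrange ▸ hy
  exact ⟨x, rfl⟩

/-- ⋆-homomorphisms to nonzero C⋆-algebras are isomorphisms from the C⋆-algebra generated by two
unitaries commuting up to a scalar which is not a root of unity onto its image. -/
theorem exists_starAlgEquiv_of_map {C D : Type*} [CStarAlgebra C] [CStarAlgebra D] [Nontrivial D]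
    (hζ : ∀ n : ℤ, (ζ : ℂ) ^ n = 1 → n = 0) {U V : unitary C}
    (hUV : U * V = scalarUnitary C ζ * (V * U)) (Φ : C →⋆ₐ[ℂ] D) {a b : D}
    (ha : Φ U = a) (hb : Φ V = b) :
    ∃ φ : (StarAlgebra.adjoin ℂ ({↑U, ↑V} : Set C)).topologicalClosure ≃⋆ₐ[ℂ]
      (StarAlgebra.adjoin ℂ ({a, b} : Set D)).topologicalClosure, ∀ x, (φ x : D) = Φ x :=
  exists_starAlgEquiv_of_injOn Φ _
    (fun x hx y hy hxy => sub_eq_zero.1 (eq_zero_of_map_eq_zero hζ hUV Φ (sub_mem hx hy)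
      (by rw [map_sub, hxy, sub_self])))
    (by rw [Set.image_pair, ha, hb])

theorem exists_starAlgEquiv_of_map_of_map {C D D' : Type*} [CStarAlgebra C] [CStarAlgebra D]
    [Nontrivial D] [CStarAlgebra D'] [Nontrivial D']
    (hζ : ∀ n : ℤ, (ζ : ℂ) ^ n = 1 → n = 0) {U V : unitary C}
    (hUV : U * V = scalarUnitary C ζ * (V * U)) (Φ : C →⋆ₐ[ℂ] D) (Φ' : C →⋆ₐ[ℂ] D')
    {a b : D} {a' b' : D'} (ha : Φ U = a) (hb : Φ V = b) (ha' : Φ' U = a') (hb' : Φ' V = b') :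
    ∃ φ : (StarAlgebra.adjoin ℂ ({a, b} : Set D)).topologicalClosure ≃⋆ₐ[ℂ]
        (StarAlgebra.adjoin ℂ ({a', b'} : Set D')).topologicalClosure,
      (φ ⟨a, mem_closure_adjoin_of_mem'' _ (Set.mem_insert _ _)⟩ : D') = a' ∧
      (φ ⟨b, mem_closure_adjoin_of_mem'' _ (Set.mem_insert_of_mem _ rfl)⟩ : D') = b' := by
  obtain ⟨φ₁, hφ₁⟩ := exists_starAlgEquiv_of_map hζ hUV Φ ha hb
  obtain ⟨φ₂, hφ₂⟩ := exists_starAlgEquiv_of_map hζ hUV Φ' ha' hb'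
  have hφ : ∀ (w : C) (hw : w ∈ ({↑U, ↑V} : Set C)) (d : D) (hd : Φ w = d)
      (hd' : d ∈ (StarAlgebra.adjoin ℂ ({a, b} : Set D)).topologicalClosure),
      (φ₂ (φ₁.symm ⟨d, hd'⟩) : D') = Φ' w := by
    intro w hw d hd hd'
    have h₁ : φ₁ ⟨w, mem_closure_adjoin_of_mem'' _ hw⟩ = ⟨d, hd'⟩ :=
      Subtype.ext ((hφ₁ _).trans hd)
    rw [← h₁, φ₁.symm_apply_apply, hφ₂]
  exact ⟨φ₁.symm.trans φ₂, (hφ U (Set.mem_insert _ _) a ha _).trans ha',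
    (hφ V (Set.mem_insert_of_mem _ rfl) b hb _).trans hb'⟩

/-- The C⋆-algebra generated by two unitaries commuting up to a scalar `ζ` which is not a root of
unity depends only on `ζ`. -/
theorem exists_starAlgEquiv_of_mul_eq {A' : Type*} [CStarAlgebra A'] [Nontrivial A]
    [Nontrivial A'] {u' v' : unitary A'}
    (hζ : ∀ n : ℤ, (ζ : ℂ) ^ n = 1 → n = 0) (h : u * v = scalarUnitary A ζ * (v * u))
    (h' : u' * v' = scalarUnitary A' ζ * (v' * u')) :
    ∃ φ : (StarAlgebra.adjoin ℂ ({↑u, ↑v} : Set A)).topologicalClosure ≃⋆ₐ[ℂ]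
        (StarAlgebra.adjoin ℂ ({↑u', ↑v'} : Set A')).topologicalClosure,
      (φ ⟨↑u, mem_closure_adjoin_of_mem'' _ (Set.mem_insert _ _)⟩ : A') = u' ∧
      (φ ⟨↑v, mem_closure_adjoin_of_mem'' _ (Set.mem_insert_of_mem _ rfl)⟩ : A') = v' := by
  let U : unitary (A × A') := ⟨(u, u'), by simp [Unitary.mem_iff, Prod.ext_iff]⟩
  let V : unitary (A × A') := ⟨(v, v'), by simp [Unitary.mem_iff, Prod.ext_iff]⟩
  have hUV : U * V = scalarUnitary (A × A') ζ * (V * U) :=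
    Subtype.ext (Prod.ext (congrArg Subtype.val h) (congrArg Subtype.val h'))
  exact exists_starAlgEquiv_of_map_of_map hζ hUV (StarAlgHom.fst ℂ A A') (StarAlgHom.snd ℂ A A')
    rfl rfl rfl rfl

theorem adjoin_le_of_isMonomial {m n m' n' : ℤ}
    (hu' : IsMonomial (scalarUnitary A ζ) u v m n u')
    (hv' : IsMonomial (scalarUnitary A ζ) u v m' n' v') :
    StarAlgebra.adjoin ℂ ({↑u', ↑v'} : Set A) ≤ StarAlgebra.adjoin ℂ ({↑u, ↑v} : Set A) := by
  refine StarAlgebra.adjoin_le ?_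
  rintro _ (rfl | rfl)
  exacts [hu'.mem_adjoin, hv'.mem_adjoin]

/-- Monomials whose exponent matrix has determinant one generate the same star-subalgebra. -/
theorem adjoin_eq_of_isMonomial (h : u * v = scalarUnitary A ζ * (v * u)) {p q r s : ℤ}
    (hdet : p * s - q * r = 1)
    (hu' : IsMonomial (scalarUnitary A ζ) u v p q u')
    (hv' : IsMonomial (scalarUnitary A ζ) u v r s v') :
    StarAlgebra.adjoin ℂ ({↑u', ↑v'} : Set A) = StarAlgebra.adjoin ℂ ({↑u, ↑v} : Set A) := by
  have hz := scalarUnitary_commute (C := A) ζ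
  have aux : ∀ (a b m n : ℤ) (w : unitary A), a * p + b * r = m → a * q + b * s = n →
      IsMonomial (scalarUnitary A ζ) u v m n w → IsMonomial (scalarUnitary A ζ) u' v' a b w := by
    rintro a b _ _ w rfl rfl ⟨k, hk⟩
    obtain ⟨l, hl⟩ := (hu'.zpow hz h a).mul hz h (hv'.zpow hz h b)
    refine ⟨k - l, ?_⟩
    rw [hk, hl, ← mul_assoc (_ ^ (k - l)), ← zpow_add, sub_add_cancel]
  refine le_antisymm (adjoin_le_of_isMonomial hu' hv') (adjoin_le_of_isMonomial
    (aux s (-q) 1 0 u (by linarith) (by ring) isMonomial_left)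
    (aux (-r) p 0 1 v (by ring) (by linarith) isMonomial_right))

end Torus

theorem exp_zpow_eq_one_of_irrational {θ : ℝ} (hθ : Irrational θ) (n : ℤ)
    (hn : Complex.exp (2 * Real.pi * Complex.I * θ) ^ n = 1) : n = 0 := by
  rw [← Complex.exp_int_mul, Complex.exp_eq_one_iff] at hn
  obtain ⟨m, hm⟩ := hn
  by_contra hn0
  have h2 : (n : ℂ) * θ = m := by
    refine mul_right_cancel₀ Complex.two_pi_I_ne_zero ?_
    rw [← hm]; ring
  have h3 : (n : ℝ) * θ = m := by exact_mod_cast h2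
  exact (hθ.intCast_mul hn0).ne_int m h3

/-- **The `SL(2,ℤ)` automorphisms of the quantum torus.**  If `θ` is irrational,
`u, v` are unitaries satisfying the `θ`-commutation relation and `p·s − q·r = 1`, then
there is a star-algebra automorphism of the generated C*-algebra sending
`u ↦ u^p v^q` and `v ↦ u^r v^s`. -/
theorem quantum_torus_sl2_automorphism
    {A : Type*} [CStarAlgebra A] (θ : ℝ) (hθ : Irrational θ) (u v : unitary A)
    (huv : (u : A) * v = Complex.exp (2 * Real.pi * Complex.I * θ) • ((v : A) * u))
    (p q r s : ℤ) (hdet : p * s - q * r = 1) :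
    ∃ φ : (StarAlgebra.adjoin ℂ ({↑u, ↑v} : Set A)).topologicalClosure ≃⋆ₐ[ℂ]
        (StarAlgebra.adjoin ℂ ({↑u, ↑v} : Set A)).topologicalClosure,
      (φ ⟨↑u, mem_closure_adjoin_of_mem'' _ (Set.mem_insert _ _)⟩ : A) =
        ((u ^ p * v ^ q : unitary A) : A) ∧
      (φ ⟨↑v, mem_closure_adjoin_of_mem'' _ (Set.mem_insert_of_mem _ rfl)⟩ : A) =
        ((u ^ r * v ^ s : unitary A) : A) := by
  rcases subsingleton_or_nontrivial A with hA | hA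
  · exact ⟨StarAlgEquiv.refl .., Subsingleton.elim _ _, Subsingleton.elim _ _⟩
  have hnorm : ‖Complex.exp (2 * Real.pi * Complex.I * θ)‖ = 1 := by
    rw [show 2 * Real.pi * Complex.I * θ = ((2 * Real.pi * θ : ℝ) : ℂ) * Complex.I by
      push_cast; ring, Complex.norm_exp_ofReal_mul_I]
  let ζ : unitary ℂ := ⟨Complex.exp (2 * Real.pi * Complex.I * θ), by
    rw [Unitary.mem_iff_self_mul_star, Complex.star_def, Complex.mul_conj, Complex.normSq_eq_norm_sq,
      hnorm]
    simp⟩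
  have h : u * v = scalarUnitary A ζ * (v * u) :=
    Subtype.ext (huv.trans (Algebra.smul_def _ _))
  have hu' := isMonomial_zpow_mul_zpow (z := scalarUnitary A ζ) (u := u) (v := v) p q
  have hv' := isMonomial_zpow_mul_zpow (z := scalarUnitary A ζ) (u := u) (v := v) r s
  have h' := hu'.mul_comm (scalarUnitary_commute ζ) h hv'
  rw [hdet, zpow_one] at h'
  have key := exists_starAlgEquiv_of_mul_eq (exp_zpow_eq_one_of_irrational hθ) h h'
  rwa [adjoin_eq_of_isMonomial h hdet hu' hv'] at key
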